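/- arXiv:2002.12698 — 3 statements merged into one kernel-verified Lean document; each statement's English description precedes it below -/
import Mathlib

section
/- Let f : ℝ → ℝ and set g(t) := t·f(t). Assume f = f₁ + f₂ and g = g₁ + g₂ where f₁, g₁ ∈ L¹(ℝ) and f₂, g₂ ∈ BV₀(ℝ), and assume that for every s ≠ 0 the limits F(s) := lim_{T→∞} F_T(f)(s) and G(s) := lim_{T→∞} F_T(g)(s) exist. Then for all nonzero α, β of the same sign (so that 0 ∉ [min(α,β), max(α,β)]), F(β) − F(α) = −i ∫_α^β G(s) ds; consequently, at every s ≠ 0 at which G is continuous, F is differentiable with F′(s) = −i·G(s). (Theorem 5.1: differentiability of the HK-Fourier transform.) -/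
open MeasureTheory Filter
open scoped ENNReal

/-- `BV₀(ℝ)`: functions of finite total variation on `ℝ` vanishing at `±∞`. -/
def BV0 (v : ℝ → ℝ) : Prop :=
  eVariationOn v Set.univ < ⊤ ∧ Tendsto v atTop (nhds 0) ∧ Tendsto v atBot (nhds 0)

/-- Truncated Fourier integral `F_T(f)(s) = (1/√(2π)) ∫_{-T}^{T} e^{-ist} f(t) dt`. -/
noncomputable def truncFourier (f : ℝ → ℝ) (T s : ℝ) : ℂ :=
  ((1 / Real.sqrt (2 * Real.pi) : ℝ) : ℂ) *
    ∫ t in (-T)..T, Complex.exp (-(Complex.I * s * t)) * (f t : ℂ)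

/-- The Fourier kernel has norm one. -/
lemma norm_kernel (s t : ℝ) : ‖Complex.exp (-(Complex.I * s * t))‖ = 1 := by
  rw [Complex.norm_exp]
  simp

/-- A function in `BV₀` is a difference of bounded monotone functions. -/
lemma BV0.exists_monotone {v : ℝ → ℝ} (hv : BV0 v) :
    ∃ (p q : ℝ → ℝ) (M : ℝ), Monotone p ∧ Monotone q ∧ (∀ t, |p t| ≤ M) ∧ (∀ t, |q t| ≤ M) ∧
      ∀ t, v t = p t - q t := by
  have hb : BoundedVariationOn v Set.univ := hv.1.ne
  have hl := hb.locallyBoundedVariationOn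
  set W := (eVariationOn v Set.univ).toReal with hW
  have hV : ∀ t, |variationOnFromTo v Set.univ 0 t| ≤ W := fun t =>
    variationOnFromTo.abs_le_eVariationOn hb
  have hW0 : 0 ≤ W := ENNReal.toReal_nonneg
  refine ⟨variationOnFromTo v Set.univ 0, variationOnFromTo v Set.univ 0 - v, 2 * W + |v 0|,
    monotoneOn_univ.1 (variationOnFromTo.monotoneOn hl (Set.mem_univ 0)),
    monotoneOn_univ.1 (variationOnFromTo.sub_self_monotoneOn hl (Set.mem_univ 0)), ?_, ?_, ?_⟩
  · intro t
    have := hV t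
    have := abs_nonneg (v 0)
    linarith
  · intro t
    have h1 := hV t
    have h2 : dist (v t) (v 0) ≤ W := hb.dist_le (Set.mem_univ t) (Set.mem_univ 0)
    rw [Real.dist_eq] at h2
    have h3 := abs_sub (variationOnFromTo v Set.univ 0 t) (v t)
    have h4 : |v t| ≤ |v t - v 0| + |v 0| := by
      have := abs_add_le (v t - v 0) (v 0)
      simpa using this
    simp only [Pi.sub_apply]
    linarith
  · intro t
    simp

lemma intervalIntegrable_kernel_mul {p : ℝ → ℝ} {a b : ℝ} (hp : IntervalIntegrable p volume a b)
    (s : ℝ) :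
    IntervalIntegrable (fun t : ℝ => Complex.exp (-(Complex.I * s * t)) * (p t : ℂ)) volume a b := by
  have h : IntervalIntegrable (fun t => (p t : ℂ)) volume a b :=
    ⟨hp.1.ofReal, hp.2.ofReal⟩
  exact h.continuousOn_mul (by fun_prop)

/-- Bound for the oscillatory integral of a bounded monotone function. -/
lemma monotone_bound {p : ℝ → ℝ} (hp : Monotone p) {M : ℝ} (hM : ∀ t, |p t| ≤ M) {s T : ℝ}
    (hs : s ≠ 0) (hT : 0 ≤ T) :
    ‖∫ t in (-T)..T, Complex.exp (-(Complex.I * s * t)) * (p t : ℂ)‖ ≤ 2 * (Real.pi / |s|) * M := by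
  set h := Real.pi / |s| with hh
  have hs' : 0 < |s| := abs_pos.2 hs
  have hh0 : 0 < h := by positivity
  have hq : Monotone (fun t => p (t - h)) := fun a b hab => hp (by linarith)
  have hpi : ∀ a b, IntervalIntegrable p volume a b := fun a b => hp.intervalIntegrable
  have hqi : ∀ a b, IntervalIntegrable (fun t => p (t - h)) volume a b :=
    fun a b => hq.intervalIntegrable
  have hshift : ∀ t : ℝ, Complex.exp (-(Complex.I * s * ((t - h : ℝ) : ℂ))) =
      - Complex.exp (-(Complex.I * s * t)) := by
    intro t
    have e1 : -(Complex.I * s * ((t - h : ℝ) : ℂ)) =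
        -(Complex.I * s * t) + ((s * h : ℝ) : ℂ) * Complex.I := by
      push_cast; ring
    rw [e1, Complex.exp_add]
    have : Complex.exp (((s * h : ℝ) : ℂ) * Complex.I) = -1 := by
      rcases lt_or_gt_of_ne hs with h0 | h0
      · have : s * h = -Real.pi := by
          rw [hh, abs_of_neg h0]; field_simp
        rw [this]
        push_cast
        rw [neg_mul, Complex.exp_neg, Complex.exp_pi_mul_I]; norm_num
      · have : s * h = Real.pi := by
          rw [hh, abs_of_pos h0]; field_simp
        rw [this, Complex.exp_pi_mul_I]
    rw [this]; ring
  set I := ∫ t in (-T)..T, Complex.exp (-(Complex.I * s * t)) * (p t : ℂ) with hI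
  have hI2 : I = - ∫ t in (-T + h)..(T + h),
      Complex.exp (-(Complex.I * s * t)) * ((p (t - h) : ℝ) : ℂ) := by
    have := intervalIntegral.integral_comp_sub_right (a := -T + h) (b := T + h)
      (fun t : ℝ => Complex.exp (-(Complex.I * s * t)) * (p t : ℂ)) h
    simp only [add_sub_cancel_right] at this
    rw [hI, ← this, ← intervalIntegral.integral_neg]
    refine intervalIntegral.integral_congr fun t _ => ?_
    simp only [hshift]
    ring
  have kp := fun a b => intervalIntegrable_kernel_mul (hpi a b) s
  have kq := fun a b => intervalIntegrable_kernel_mul (hqi a b) s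
  have h2I : I + I = (∫ t in (-T)..T, Complex.exp (-(Complex.I * s * t)) *
        ((p t - p (t - h) : ℝ) : ℂ)) +
      ((∫ t in (-T)..(-T + h), Complex.exp (-(Complex.I * s * t)) * ((p (t - h) : ℝ) : ℂ)) -
       ∫ t in T..(T + h), Complex.exp (-(Complex.I * s * t)) * ((p (t - h) : ℝ) : ℂ)) := by
    rw [← intervalIntegral.integral_interval_sub_interval_comm (kq _ _) (kq _ _) (kq _ _)]
    have : (∫ t in (-T)..T, Complex.exp (-(Complex.I * s * t)) * ((p t - p (t - h) : ℝ) : ℂ)) =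
        I - ∫ t in (-T)..T, Complex.exp (-(Complex.I * s * t)) * ((p (t - h) : ℝ) : ℂ) := by
      rw [hI, ← intervalIntegral.integral_sub (kp _ _) (kq _ _)]
      refine intervalIntegral.integral_congr fun t _ => ?_
      push_cast; ring
    rw [this]
    nth_rewrite 2 [hI2]
    ring
  have b1 : ‖∫ t in (-T)..T, Complex.exp (-(Complex.I * s * t)) *
        ((p t - p (t - h) : ℝ) : ℂ)‖ ≤ 2 * h * M := by
    have c1 : ‖∫ t in (-T)..T, Complex.exp (-(Complex.I * s * t)) *
        ((p t - p (t - h) : ℝ) : ℂ)‖ ≤ ∫ t in (-T)..T, (p t - p (t - h)) := by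
      refine intervalIntegral.norm_integral_le_of_norm_le (by linarith) ?_ ((hpi _ _).sub (hqi _ _))
      refine Eventually.of_forall fun t _ => ?_
      rw [norm_mul, norm_kernel, one_mul, Complex.norm_real, Real.norm_eq_abs, abs_of_nonneg]
      have : p (t - h) ≤ p t := hp (by linarith)
      linarith
    have c2 : ∫ t in (-T)..T, (p t - p (t - h)) =
        (∫ t in (T - h)..T, p t) - ∫ t in (-T - h)..(-T), p t := by
      rw [intervalIntegral.integral_sub (hpi _ _) (hqi _ _),
        intervalIntegral.integral_comp_sub_right,
        intervalIntegral.integral_interval_sub_interval_comm' (hpi _ _) (hpi _ _) (hpi _ _)]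
    have c3 : ‖∫ t in (T - h)..T, p t‖ ≤ M * |T - (T - h)| :=
      intervalIntegral.norm_integral_le_of_norm_le_const fun t _ => hM t
    have c4 : ‖∫ t in (-T - h)..(-T), p t‖ ≤ M * |(-T) - (-T - h)| :=
      intervalIntegral.norm_integral_le_of_norm_le_const fun t _ => hM t
    rw [sub_sub_cancel, abs_of_pos hh0, Real.norm_eq_abs] at c3 c4
    have c5 := (abs_le.1 c3).2
    have c6 := (abs_le.1 c4).1
    rw [c2] at c1
    linarith
  have b2 : ∀ a : ℝ, ‖∫ t in a..(a + h), Complex.exp (-(Complex.I * s * t)) *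
      ((p (t - h) : ℝ) : ℂ)‖ ≤ M * h := by
    intro a
    have := intervalIntegral.norm_integral_le_of_norm_le_const (a := a) (b := a + h) (C := M)
      (f := fun t : ℝ => Complex.exp (-(Complex.I * s * t)) * ((p (t - h) : ℝ) : ℂ)) fun t _ => by
        rw [norm_mul, norm_kernel, one_mul, Complex.norm_real]
        exact hM _
    rwa [add_sub_cancel_left, abs_of_pos hh0] at this
  have b3 := b2 (-T)
  have b4 := b2 T
  have n1 : ‖I + I‖ = 2 * ‖I‖ := by
    rw [← two_mul, norm_mul]; simp
  rw [h2I] at n1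
  have n2 := norm_add_le (∫ t in (-T)..T, Complex.exp (-(Complex.I * s * t)) *
        ((p t - p (t - h) : ℝ) : ℂ))
      ((∫ t in (-T)..(-T + h), Complex.exp (-(Complex.I * s * t)) * ((p (t - h) : ℝ) : ℂ)) -
       ∫ t in T..(T + h), Complex.exp (-(Complex.I * s * t)) * ((p (t - h) : ℝ) : ℂ))
  have n3 := norm_sub_le
      (∫ t in (-T)..(-T + h), Complex.exp (-(Complex.I * s * t)) * ((p (t - h) : ℝ) : ℂ))
      (∫ t in T..(T + h), Complex.exp (-(Complex.I * s * t)) * ((p (t - h) : ℝ) : ℂ))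
  linarith

lemma BV0.intervalIntegrable {v : ℝ → ℝ} (hv : BV0 v) (a b : ℝ) :
    IntervalIntegrable v volume a b := by
  obtain ⟨p, q, M, hp, hq, -, -, h⟩ := hv.exists_monotone
  have : v = fun t => p t - q t := funext h
  rw [this]
  exact hp.intervalIntegrable.sub hq.intervalIntegrable

/-- Uniform bound for truncated Fourier integrals of functions in `L¹ + BV₀`. -/
lemma truncFourier_bound {g g₁ g₂ : ℝ → ℝ} (hg : ∀ t, g t = g₁ t + g₂ t) (hg₁ : Integrable g₁)
    (hg₂ : BV0 g₂) : ∃ A B : ℝ, 0 ≤ B ∧ ∀ s T : ℝ, s ≠ 0 → 0 ≤ T →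
      ‖truncFourier g T s‖ ≤ A + B / |s| := by
  obtain ⟨p, q, M, hp, hq, hpM, hqM, h⟩ := hg₂.exists_monotone
  have hM : 0 ≤ M := (abs_nonneg _).trans (hpM 0)
  set c : ℝ := 1 / Real.sqrt (2 * Real.pi) with hc
  have hc0 : 0 ≤ c := by positivity
  have hpi := Real.pi_pos
  refine ⟨c * ∫ t, ‖g₁ t‖, c * (4 * Real.pi * M), by positivity, fun s T hs hT => ?_⟩
  have k1 := intervalIntegrable_kernel_mul (hg₁.intervalIntegrable (a := -T) (b := T)) s
  have k2 := intervalIntegrable_kernel_mul (hp.intervalIntegrable (μ := volume) (a := -T) (b := T)) s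
  have k3 := intervalIntegrable_kernel_mul (hq.intervalIntegrable (μ := volume) (a := -T) (b := T)) s
  have e : (∫ t in (-T)..T, Complex.exp (-(Complex.I * s * t)) * (g t : ℂ)) =
      (∫ t in (-T)..T, Complex.exp (-(Complex.I * s * t)) * (g₁ t : ℂ)) +
      ((∫ t in (-T)..T, Complex.exp (-(Complex.I * s * t)) * (p t : ℂ)) -
       ∫ t in (-T)..T, Complex.exp (-(Complex.I * s * t)) * (q t : ℂ)) := by
    rw [← intervalIntegral.integral_sub k2 k3, ← intervalIntegral.integral_add k1 (k2.sub k3)]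
    refine intervalIntegral.integral_congr fun t _ => ?_
    simp only [hg, h]
    push_cast; ring
  have b1 : ‖∫ t in (-T)..T, Complex.exp (-(Complex.I * s * t)) * (g₁ t : ℂ)‖ ≤ ∫ t, ‖g₁ t‖ := by
    have hle : -T ≤ T := by linarith
    refine (intervalIntegral.norm_integral_le_integral_norm hle).trans ?_
    simp only [norm_mul, norm_kernel, one_mul, Complex.norm_real]
    rw [intervalIntegral.integral_of_le hle]
    exact setIntegral_le_integral hg₁.norm (Eventually.of_forall fun t => norm_nonneg _)
  have b2 := monotone_bound hp hpM hs hT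
  have b3 := monotone_bound hq hqM hs hT
  have hfin : ‖∫ t in (-T)..T, Complex.exp (-(Complex.I * s * t)) * (g t : ℂ)‖ ≤
      (∫ t, ‖g₁ t‖) + 4 * Real.pi * M / |s| := by
    rw [e]
    refine (norm_add_le _ _).trans ?_
    have := norm_sub_le (∫ t in (-T)..T, Complex.exp (-(Complex.I * s * t)) * (p t : ℂ))
      (∫ t in (-T)..T, Complex.exp (-(Complex.I * s * t)) * (q t : ℂ))
    have e2 : 4 * Real.pi * M / |s| = 2 * (Real.pi / |s|) * M + 2 * (Real.pi / |s|) * M := by ring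
    linarith
  rw [truncFourier, norm_mul, Complex.norm_real, Real.norm_of_nonneg hc0]
  calc _ ≤ c * ((∫ t, ‖g₁ t‖) + 4 * Real.pi * M / |s|) := by gcongr
    _ = _ := by ring

lemma truncFourier_continuous {g : ℝ → ℝ} (hg : ∀ a b, IntervalIntegrable g volume a b) (T : ℝ) :
    Continuous (truncFourier g T) := by
  unfold truncFourier
  refine continuous_const.mul ?_
  refine intervalIntegral.continuous_of_dominated_interval (bound := fun t => ‖g t‖) ?_ ?_ ?_ ?_
  · intro s
    exact (intervalIntegrable_iff.1 (intervalIntegrable_kernel_mul (hg _ _) s)).aestronglyMeasurable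
  · intro s
    refine Eventually.of_forall fun t _ => ?_
    rw [norm_mul, norm_kernel, one_mul, Complex.norm_real]
  · exact (hg _ _).norm
  · refine Eventually.of_forall fun t _ => ?_
    fun_prop

/-- The theorem for truncated integrals (Fubini). -/
lemma truncFourier_sub {f : ℝ → ℝ} (hf : ∀ a b, IntervalIntegrable f volume a b) (T α β : ℝ) :
    truncFourier f T β - truncFourier f T α =
      -Complex.I * ∫ s in α..β, truncFourier (fun t => t * f t) T s := by
  have hg : IntervalIntegrable (fun t => t * f t) volume (-T) T :=
    (hf _ _).continuousOn_mul (by fun_prop)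
  unfold truncFourier
  rw [intervalIntegral.integral_const_mul, intervalIntegral_intervalIntegral_swap]
  · rw [← mul_sub, mul_left_comm, ← intervalIntegral.integral_sub
      (intervalIntegrable_kernel_mul (hf _ _) _) (intervalIntegrable_kernel_mul (hf _ _) _)]
    congr 1
    rw [← intervalIntegral.integral_const_mul]
    refine intervalIntegral.integral_congr fun t _ => ?_
    simp only
    rw [← intervalIntegral.integral_const_mul]
    have hd : ∀ s : ℝ, HasDerivAt (fun s : ℝ => Complex.exp (-(Complex.I * s * t)) * (f t : ℂ))
        (-Complex.I * (Complex.exp (-(Complex.I * s * t)) * ((t * f t : ℝ) : ℂ))) s := by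
      intro s
      have h1 : HasDerivAt (fun s : ℝ => -(Complex.I * (s : ℂ) * t)) (-(Complex.I * 1 * t)) s :=
        (((Complex.ofRealCLM.hasDerivAt (x := s)).const_mul Complex.I).mul_const (t : ℂ)).neg
      have h2 := (h1.cexp).mul_const (f t : ℂ)
      have h3 : -Complex.I * (Complex.exp (-(Complex.I * s * t)) * ((t * f t : ℝ) : ℂ)) =
          Complex.exp (-(Complex.I * s * t)) * -(Complex.I * 1 * t) * (f t : ℂ) := by
        push_cast; ring
      rw [h3]
      exact h2
    rw [intervalIntegral.integral_eq_sub_of_hasDerivAt (fun s _ => hd s)]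
    apply Continuous.intervalIntegrable
    fun_prop
  · have h1 : Integrable (fun _ : ℝ => (1 : ℂ)) (volume.restrict (Set.uIoc α β)) := by
      exact (intervalIntegrable_iff.1 (intervalIntegrable_const (a := α) (b := β)))
    have h2 : Integrable (fun t : ℝ => ((t * f t : ℝ) : ℂ)) (volume.restrict (Set.uIoc (-T) T)) :=
      (intervalIntegrable_iff.1 hg).ofReal
    have h3 := h1.mul_prod h2
    rw [IntegrableOn, Measure.volume_eq_prod, ← Measure.prod_restrict]
    refine h3.mono ?_ ?_
    · have h4 := h3.aestronglyMeasurable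
      have h5 : Continuous (fun z : ℝ × ℝ => Complex.exp (-(Complex.I * z.1 * z.2))) := by fun_prop
      have h6 := h5.aestronglyMeasurable.mul h4
      refine h6.congr (Eventually.of_forall fun z => ?_)
      simp [Function.uncurry]
    · refine Eventually.of_forall fun z => ?_
      simp only [Function.uncurry, norm_mul, norm_kernel, norm_one, le_refl]

/-- Theorem 5.1: if `f` and `g(t) = t·f(t)` both lie in `L¹(ℝ) + BV₀(ℝ)` and their improper
Fourier integrals `F`, `G` exist away from `0`, then `F(β) - F(α) = -i ∫_α^β G(s) ds` whenever
`α, β` are nonzero of the same sign; consequently `F` is differentiable with `F' = -i·G` at every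
`s ≠ 0` where `G` is continuous. -/
theorem fourierHK_hasDerivAt
    (f f₁ f₂ g₁ g₂ : ℝ → ℝ) (F G : ℝ → ℂ)
    (hf : ∀ t, f t = f₁ t + f₂ t) (hg : ∀ t, t * f t = g₁ t + g₂ t)
    (hf₁ : Integrable f₁) (hg₁ : Integrable g₁)
    (hf₂ : BV0 f₂) (hg₂ : BV0 g₂)
    (hF : ∀ s : ℝ, s ≠ 0 → Tendsto (fun T : ℝ => truncFourier f T s) atTop (nhds (F s)))
    (hG : ∀ s : ℝ, s ≠ 0 →
      Tendsto (fun T : ℝ => truncFourier (fun t => t * f t) T s) atTop (nhds (G s))) :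
    (∀ α β : ℝ, 0 < α * β → F β - F α = -Complex.I * ∫ s in α..β, G s) ∧
    (∀ s : ℝ, s ≠ 0 → ContinuousAt G s → HasDerivAt F (-Complex.I * G s) s) := by
  have hfi : ∀ a b, IntervalIntegrable f volume a b := by
    intro a b
    have : f = fun t => f₁ t + f₂ t := funext hf
    rw [this]
    exact hf₁.intervalIntegrable.add (hf₂.intervalIntegrable a b)
  have hgi : ∀ a b, IntervalIntegrable (fun t => t * f t) volume a b := fun a b =>
    (hfi a b).continuousOn_mul (by fun_prop)
  obtain ⟨A, B, hB, hbd⟩ := truncFourier_bound hg hg₁ hg₂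
  have main : ∀ α β : ℝ, 0 < α * β → F β - F α = -Complex.I * ∫ s in α..β, G s := by
    intro α β hαβ
    have hα : α ≠ 0 := by rintro rfl; simp at hαβ
    have hβ : β ≠ 0 := by rintro rfl; simp at hαβ
    set m := min |α| |β| with hm
    have hm0 : 0 < m := lt_min (abs_pos.2 hα) (abs_pos.2 hβ)
    have hmem : ∀ s ∈ Set.uIoc α β, m ≤ |s| := by
      intro s hs
      have hs := Set.uIoc_subset_uIcc hs
      rcases pos_and_pos_or_neg_and_neg_of_mul_pos hαβ with ⟨h1, h2⟩ | ⟨h1, h2⟩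
      · rw [hm, abs_of_pos h1, abs_of_pos h2]
        exact hs.1.trans (le_abs_self s)
      · rw [hm, abs_of_neg h1, abs_of_neg h2, min_neg_neg]
        exact (neg_le_neg hs.2).trans (neg_le_abs s)
    have hlim : Tendsto (fun T => ∫ s in α..β, truncFourier (fun t => t * f t) T s) atTop
        (nhds (∫ s in α..β, G s)) := by
      refine intervalIntegral.tendsto_integral_filter_of_dominated_convergence
        (fun _ => A + B / m) ?_ ?_ intervalIntegrable_const ?_
      · exact Eventually.of_forall fun T => (truncFourier_continuous hgi T).aestronglyMeasurable
      · filter_upwards [eventually_ge_atTop (0 : ℝ)] with T hT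
        refine Eventually.of_forall fun s hs => ?_
        have h1 := hmem s hs
        have h0 : s ≠ 0 := abs_pos.1 (hm0.trans_le h1)
        refine (hbd s T h0 hT).trans ?_
        gcongr
      · refine Eventually.of_forall fun s hs => hG s ?_
        exact abs_pos.1 (hm0.trans_le (hmem s hs))
    have h1 := (hF β hβ).sub (hF α hα)
    have h2 := hlim.const_mul (-Complex.I)
    refine tendsto_nhds_unique h1 (h2.congr fun T => ?_)
    exact (truncFourier_sub hfi T α β).symm
  refine ⟨main, fun s hs hc => ?_⟩
  have hGm : AEStronglyMeasurable G volume := by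
    refine aestronglyMeasurable_of_tendsto_ae (atTop : Filter ℝ)
      (f := fun T => truncFourier (fun t => t * f t) T)
      (fun T => (truncFourier_continuous hgi T).aestronglyMeasurable) ?_
    filter_upwards [Measure.ae_ne volume (0 : ℝ)] with x hx using hG x hx
  have hd : HasDerivAt (fun u => ∫ x in s..u, G x) (G s) s :=
    intervalIntegral.integral_hasDerivAt_right IntervalIntegrable.refl
      hGm.stronglyMeasurableAtFilter hc
  have hd2 := (hd.const_mul (-Complex.I)).const_add (F s)
  refine hd2.congr_of_eventuallyEq ?_
  have hev : ∀ᶠ u in nhds s, 0 < s * u := by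
    have : ContinuousAt (fun u : ℝ => s * u) s := by fun_prop
    exact this.eventually (lt_mem_nhds (mul_self_pos.2 hs))
  filter_upwards [hev] with u hu
  have := main s u hu
  rw [← this]; ring
end

section
/- Let v ∈ BV₀(ℝ) and let s ≠ 0 be a real number. Then the improper integrals lim_{T→∞} ∫_{−T}^{T} cos(st)·v(t) dt and lim_{T→∞} ∫_{−T}^{T} sin(st)·v(t) dt both exist and are finite. (Existence of the HK-Cosine and HK-Sine Fourier transforms of a function in BV₀(ℝ) at every s ≠ 0, used throughout Sections 3–5.) -/
open MeasureTheory Filter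
open scoped ENNReal

theorem bv0_boundary (v g : ℝ → ℝ) (h M : ℝ) (hg : Continuous g) (hg1 : ∀ t, |g t| ≤ 1)
    (hm : Measurable v) (hM : ∀ t, |v t| ≤ M) (l : Filter ℝ) [l.IsCountablyGenerated]
    (hl : ∀ u : ℝ, Tendsto (fun x => v (x + u)) l (nhds 0)) :
    Tendsto (fun x => ∫ t in x..(x + h), g t * v t) l (nhds 0) := by
  have key : ∀ x : ℝ, ∫ t in x..(x + h), g t * v t
      = ∫ u in (0 : ℝ)..h, g (x + u) * v (x + u) := by
    intro x
    rw [intervalIntegral.integral_comp_add_left (fun t => g t * v t) x]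
    simp
  simp only [key]
  have h0 : (0 : ℝ) = ∫ u in (0 : ℝ)..h, (0 : ℝ) := by simp
  suffices H : Tendsto (fun x => ∫ u in (0 : ℝ)..h, g (x + u) * v (x + u)) l
      (nhds (∫ u in (0 : ℝ)..h, (0 : ℝ))) by rwa [← h0] at H
  apply intervalIntegral.tendsto_integral_filter_of_dominated_convergence (fun _ => M)
  · refine Eventually.of_forall fun x => ?_
    apply Measurable.aestronglyMeasurable
    have := hg.measurable
    fun_prop
  · refine Eventually.of_forall fun x => Eventually.of_forall fun u _ => ?_
    rw [Real.norm_eq_abs, abs_mul]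
    calc |g (x + u)| * |v (x + u)| ≤ 1 * |v (x + u)| :=
          mul_le_mul_of_nonneg_right (hg1 _) (abs_nonneg _)
      _ ≤ M := by rw [one_mul]; exact hM _
  · exact intervalIntegrable_const
  · refine Eventually.of_forall fun u _ => ?_
    apply squeeze_zero_norm (a := fun x => |v (x + u)|)
    · intro x
      rw [Real.norm_eq_abs, abs_mul]
      calc |g (x + u)| * |v (x + u)| ≤ 1 * |v (x + u)| :=
          mul_le_mul_of_nonneg_right (hg1 _) (abs_nonneg _)
        _ = _ := one_mul _
    · simpa using (hl u).abs

theorem bv0_main (v g : ℝ → ℝ) (h : ℝ) (hh : 0 < h)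
    (hvvar : eVariationOn v Set.univ < ⊤)
    (hvtop : Tendsto v atTop (nhds 0)) (hvbot : Tendsto v atBot (nhds 0))
    (hg : Continuous g) (hg1 : ∀ t, |g t| ≤ 1) (hgh : ∀ t, g (t + h) = - g t) :
    ∃ C : ℝ, Tendsto (fun T : ℝ => ∫ t in (-T)..T, g t * v t) atTop (nhds C) := by
  have hbv : BoundedVariationOn v Set.univ := hvvar.ne
  have hlbv := hbv.locallyBoundedVariationOn
  obtain ⟨V, hV⟩ : ∃ V, V = variationOnFromTo v Set.univ 0 := ⟨_, rfl⟩
  obtain ⟨M, hMdef⟩ : ∃ M, M = (eVariationOn v Set.univ).toReal := ⟨_, rfl⟩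
  have hVmono : Monotone V := by
    rw [hV, ← monotoneOn_univ]
    exact variationOnFromTo.monotoneOn hlbv (Set.mem_univ _)
  have hVM : ∀ t, |V t| ≤ M := fun t => by
    rw [hV, hMdef]; exact variationOnFromTo.abs_le_eVariationOn hbv
  have hUmono : Monotone (V - v) := by
    rw [hV, ← monotoneOn_univ]
    exact variationOnFromTo.sub_self_monotoneOn hlbv (Set.mem_univ _)
  have hvdiff : ∀ a b, a ≤ b → |v a - v b| ≤ V b - V a := by
    intro a b hab
    have h1 := hUmono hab
    have h2 : V a + v a ≤ V b + v b := by
      have : MonotoneOn (V + v) Set.univ := by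
        rw [hV]; exact variationOnFromTo.add_self_monotoneOn hlbv (Set.mem_univ _)
      exact this (Set.mem_univ _) (Set.mem_univ _) hab
    simp only [Pi.sub_apply] at h1
    rw [abs_le]; constructor <;> linarith
  have hvV : v = fun t => V t - (V - v) t := by ext t; simp
  have hvm : Measurable v := by
    rw [hvV]; exact hVmono.measurable.sub hUmono.measurable
  have hvM : ∀ t, |v t| ≤ M + |v 0| := by
    intro t
    have h1 : |v t - v 0| ≤ M := by
      rw [hMdef, ← Real.dist_eq]; exact hbv.dist_le (Set.mem_univ _) (Set.mem_univ _)
    have h2 := abs_sub_abs_le_abs_sub (v t) (v 0)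
    linarith
  have hvi : ∀ a b, IntervalIntegrable v volume a b := by
    intro a b
    rw [hvV]
    exact hVmono.intervalIntegrable.sub hUmono.intervalIntegrable
  have hgvi : ∀ a b, IntervalIntegrable (fun t => g t * v t) volume a b := fun a b =>
    (hvi a b).continuousOn_mul hg.continuousOn
  have hVi : ∀ a b, IntervalIntegrable V volume a b := fun a b => hVmono.intervalIntegrable
  have hVs : Monotone (fun t => V (t + h)) := fun a b hab => hVmono (by linarith)
  have hVsi : ∀ a b, IntervalIntegrable (fun t => V (t + h)) volume a b :=
    fun a b => hVs.intervalIntegrable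
  -- the difference is integrable
  have hW : Integrable (fun t => V (t + h) - V t) := by
    refine integrable_of_intervalIntegral_norm_bounded (2 * (M * h)) (a := fun T : ℝ => -T)
      (b := fun T : ℝ => T) (l := atTop) ?_ tendsto_neg_atTop_atBot tendsto_id ?_
    · intro T
      rcases le_total (-T) T with hT | hT
      · exact (intervalIntegrable_iff_integrableOn_Ioc_of_le hT).1 ((hVsi _ _).sub (hVi _ _))
      · simp [Set.Ioc_eq_empty_of_le hT]
    · refine Eventually.of_forall fun T => ?_
      have e1 : ∫ t in (-T)..T, ‖V (t + h) - V t‖ = ∫ t in (-T)..T, (V (t + h) - V t) := by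
        apply intervalIntegral.integral_congr
        intro t _
        simp only
        rw [Real.norm_eq_abs, abs_of_nonneg]
        have := hVmono (show t ≤ t + h by linarith)
        linarith
      have e2 : ∫ t in (-T)..T, (V (t + h) - V t)
          = (∫ t in T..(T + h), V t) - ∫ t in (-T)..(-T + h), V t := by
        rw [intervalIntegral.integral_sub (hVsi _ _) (hVi _ _),
          intervalIntegral.integral_comp_add_right V h]
        have a1 := intervalIntegral.integral_add_adjacent_intervals
          (hVi (-T) (-T + h)) (hVi (-T + h) (T + h))
        have a2 := intervalIntegral.integral_add_adjacent_intervals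
          (hVi (-T) T) (hVi T (T + h))
        linarith
      have bd : ∀ x : ℝ, |∫ t in x..(x + h), V t| ≤ M * h := by
        intro x
        have := intervalIntegral.norm_integral_le_of_norm_le_const (a := x) (b := x + h)
          (f := V) (C := M) (fun t _ => hVM t)
        simpa [abs_of_pos hh] using this
      rw [e1, e2]
      have b1 := abs_le.1 (bd T)
      have b2 := abs_le.1 (bd (-T))
      linarith [b1.2, b2.1]
  have hw : Integrable (fun t => g t * (v t - v (t + h))) := by
    apply hW.mono'
    · apply Measurable.aestronglyMeasurable
      have := hg.measurable
      fun_prop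
    · refine Eventually.of_forall fun t => ?_
      rw [Real.norm_eq_abs, abs_mul]
      calc |g t| * |v t - v (t + h)| ≤ 1 * |v t - v (t + h)| :=
            mul_le_mul_of_nonneg_right (hg1 _) (abs_nonneg _)
        _ ≤ _ := by rw [one_mul]; exact hvdiff _ _ (by linarith)
  have lim := intervalIntegral_tendsto_integral hw tendsto_neg_atTop_atBot
    (tendsto_id (α := ℝ) (x := atTop))
  have B1 := bv0_boundary v g h _ hg hg1 hvm hvM atTop
    (fun u => hvtop.comp (tendsto_atTop_add_const_right _ u tendsto_id))
  have B2 := (bv0_boundary v g h _ hg hg1 hvm hvM atBot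
    (fun u => hvbot.comp (tendsto_atBot_add_const_right _ u tendsto_id))).comp
      tendsto_neg_atTop_atBot
  refine ⟨_, (((lim.sub B1).add B2).const_mul (1 / 2)).congr fun T => ?_⟩
  simp only [id, Function.comp]
  have e : ∫ t in (-T)..T, g t * (v t - v (t + h))
      = (∫ t in (-T)..T, g t * v t) + ∫ t in (-T + h)..(T + h), g t * v t := by
    rw [← intervalIntegral.integral_comp_add_right (fun t => g t * v t) h,
      ← intervalIntegral.integral_add (hgvi _ _)]
    · apply intervalIntegral.integral_congr
      intro t _
      simp only [hgh]
      ring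
    · simpa using (hgvi (-T + h) (T + h)).comp_add_right h
  have a1 := intervalIntegral.integral_add_adjacent_intervals
    (hgvi (-T) (-T + h)) (hgvi (-T + h) (T + h))
  have a2 := intervalIntegral.integral_add_adjacent_intervals
    (hgvi (-T) T) (hgvi T (T + h))
  rw [e]
  linarith

/-- Existence of the HK-Cosine and HK-Sine Fourier transforms of `v ∈ BV₀(ℝ)` at every
`s ≠ 0`: the improper integrals `lim_{T→∞} ∫_{-T}^{T} cos(st)·v(t) dt` and
`lim_{T→∞} ∫_{-T}^{T} sin(st)·v(t) dt` exist and are finite. -/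
theorem cosine_sine_fourier_exists_of_BV0
    (v : ℝ → ℝ)
    (hvvar : eVariationOn v Set.univ < ⊤)
    (hvtop : Tendsto v atTop (nhds 0)) (hvbot : Tendsto v atBot (nhds 0)) :
    ∀ s : ℝ, s ≠ 0 →
      (∃ C : ℝ, Tendsto (fun T : ℝ => ∫ t in (-T)..T, Real.cos (s * t) * v t)
        atTop (nhds C)) ∧
      (∃ S : ℝ, Tendsto (fun T : ℝ => ∫ t in (-T)..T, Real.sin (s * t) * v t)
        atTop (nhds S)) := by
  intro s hs
  have hh : 0 < Real.pi / |s| := div_pos Real.pi_pos (abs_pos.2 hs)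
  have hsh : ∀ t, s * (t + Real.pi / |s|) = s * t + Real.pi ∨
      s * (t + Real.pi / |s|) = s * t - Real.pi := by
    intro t
    rcases lt_or_gt_of_ne hs with h | h
    · right; rw [abs_of_neg h]; field_simp; ring
    · left; rw [abs_of_pos h]; field_simp
  constructor
  · refine bv0_main v (fun t => Real.cos (s * t)) _ hh hvvar hvtop hvbot (by fun_prop)
      (fun t => Real.abs_cos_le_one _) fun t => ?_
    rcases hsh t with h | h <;> simp [h, Real.cos_add_pi, Real.cos_sub_pi]
  · refine bv0_main v (fun t => Real.sin (s * t)) _ hh hvvar hvtop hvbot (by fun_prop)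
      (fun t => Real.abs_sin_le_one _) fun t => ?_
    rcases hsh t with h | h <;> simp [h, Real.sin_add_pi, Real.sin_sub_pi]
end

section
/- Define φ : ℝ → ℝ by φ(t) = 1/(1+t²) for t ≥ 0 and φ(t) = 0 for t < 0. Then for every real s ≠ 0: (a) the limit G(s) := lim_{T→∞} (1/√(2π)) ∫_0^T e^{−ist}·t/(1+t²) dt exists; and (b) the function s ↦ (1/√(2π)) ∫_0^∞ e^{−ist}/(1+t²) dt (the classical Fourier transform F₁(φ)) is differentiable at s with derivative −i·G(s). (Example 1.) -/
open MeasureTheory Filter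
open scoped ENNReal

lemma aux_congr {E : Type*} [NormedAddCommGroup E] [NormedSpace ℝ E] {f g : ℝ → E} {d e : E} {x : ℝ}
    (h : HasDerivAt f d x) (hf : ∀ y, g y = f y) (hd : e = d) : HasDerivAt g e x := by
  obtain rfl : g = f := funext hf
  rw [hd]; exact h

lemma aux_norm_exp (u t : ℝ) : ‖Complex.exp (-(Complex.I * u * t))‖ = 1 := by
  rw [Complex.norm_exp]; simp

lemma aux_int (u : ℝ) (g : ℝ → ℝ) (hg : Continuous g) (hb : ∀ t, |g t| ≤ 2 * (1 + t ^ 2)⁻¹) :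
    Integrable (fun t : ℝ => Complex.exp (-(Complex.I * u * t)) * (g t : ℂ))
      (volume.restrict (Set.Ioi (0 : ℝ))) := by
  have h : Integrable (fun t : ℝ => 2 * (1 + t ^ 2)⁻¹) (volume.restrict (Set.Ioi (0 : ℝ))) :=
    (integrable_inv_one_add_sq.const_mul 2).restrict
  refine h.mono' (Continuous.aestronglyMeasurable (by fun_prop)) (ae_of_all _ fun t => ?_)
  rw [norm_mul, aux_norm_exp, one_mul, Complex.norm_real]
  exact hb t

lemma aux_pos (t : ℝ) : 1 + t ^ 2 ≠ 0 := by positivity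

lemma aux_exp_deriv (u t : ℝ) : HasDerivAt (fun t : ℝ => Complex.exp (-(Complex.I * u * t)))
    (Complex.exp (-(Complex.I * u * t)) * (-(Complex.I * u))) t := by
  have h : HasDerivAt (fun t : ℝ => -(Complex.I * u * (t : ℂ))) (-(Complex.I * u)) t := by
    exact aux_congr ((hasDerivAt_id t).ofReal_comp.const_mul (Complex.I * u)).neg
      (fun y => by simp) (by simp)
  exact h.cexp

lemma aux_exp_deriv' (u t : ℝ) : HasDerivAt (fun u : ℝ => Complex.exp (-(Complex.I * u * t)))
    (Complex.exp (-(Complex.I * u * t)) * (-(Complex.I * t))) u := by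
  have h : HasDerivAt (fun u : ℝ => -(Complex.I * (u : ℂ) * t)) (-(Complex.I * t)) u := by
    exact aux_congr (((hasDerivAt_id u).ofReal_comp.const_mul Complex.I).mul_const (t : ℂ)).neg
      (fun y => by simp) (by simp)
  exact h.cexp

lemma aux_phi_deriv (t : ℝ) :
    HasDerivAt (fun t : ℝ => 1 / (1 + t ^ 2)) (-(2 * t) / (1 + t ^ 2) ^ 2) t := by
  have h : HasDerivAt (fun t : ℝ => 1 + t ^ 2) (2 * t) t := by
    simpa using (hasDerivAt_pow 2 t).const_add 1
  exact aux_congr (h.inv (aux_pos t)) (fun y => by simp) rfl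

lemma aux_psi_deriv (t : ℝ) :
    HasDerivAt (fun t : ℝ => t / (1 + t ^ 2))
      (1 / (1 + t ^ 2) + -(2 * t ^ 2) / (1 + t ^ 2) ^ 2) t := by
  have h := (hasDerivAt_id t).mul (aux_phi_deriv t)
  refine aux_congr h (fun y => by simp [div_eq_mul_inv]) ?_
  simp only [id]; ring

lemma aux_b1 (t : ℝ) : |1 / (1 + t ^ 2)| ≤ 2 * (1 + t ^ 2)⁻¹ := by
  have : 0 ≤ (1 + t ^ 2)⁻¹ := by positivity
  rw [one_div, abs_of_nonneg this]; linarith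

lemma aux_b2 (t : ℝ) : |-(2 * t) / (1 + t ^ 2) ^ 2| ≤ 2 * (1 + t ^ 2)⁻¹ := by
  have h : 0 < 1 + t ^ 2 := by positivity
  rw [abs_div, abs_of_pos (pow_pos h 2), div_le_iff₀ (pow_pos h 2)]
  have : 2 * (1 + t ^ 2)⁻¹ * (1 + t ^ 2) ^ 2 = 2 * (1 + t ^ 2) := by field_simp
  rw [this, abs_le]
  constructor <;> nlinarith [sq_nonneg (t - 1), sq_nonneg (t + 1)]

lemma aux_b3 (t : ℝ) : |-(2 * t ^ 2) / (1 + t ^ 2) ^ 2| ≤ 2 * (1 + t ^ 2)⁻¹ := by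
  have h : 0 < 1 + t ^ 2 := by positivity
  rw [abs_div, abs_of_pos (pow_pos h 2), div_le_iff₀ (pow_pos h 2)]
  have : 2 * (1 + t ^ 2)⁻¹ * (1 + t ^ 2) ^ 2 = 2 * (1 + t ^ 2) := by field_simp
  rw [this, abs_le]
  constructor <;> nlinarith [sq_nonneg t]

lemma aux_psi_lim : Tendsto (fun t : ℝ => t / (1 + t ^ 2)) atTop (nhds 0) := by
  refine squeeze_zero' ?_ ?_ tendsto_inv_atTop_zero
  · filter_upwards [eventually_gt_atTop 0] with t ht; positivity
  · filter_upwards [eventually_gt_atTop 0] with t ht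
    rw [div_le_iff₀ (by positivity)]
    field_simp; linarith

lemma aux_phi_lim : Tendsto (fun t : ℝ => 1 / (1 + t ^ 2)) atTop (nhds 0) := by
  refine squeeze_zero' ?_ ?_ aux_psi_lim
  · filter_upwards with t; positivity
  · filter_upwards [eventually_ge_atTop 1] with t ht
    gcongr

lemma aux_lim (u : ℝ) (g : ℝ → ℝ) (hg : Tendsto g atTop (nhds 0)) :
    Tendsto (fun t : ℝ => Complex.exp (-(Complex.I * u * t)) * (g t : ℂ)) atTop (nhds 0) := by
  rw [tendsto_zero_iff_norm_tendsto_zero] at hg ⊢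
  refine hg.congr fun t => ?_
  rw [norm_mul, aux_norm_exp, one_mul, Complex.norm_real]

/-- transform of `g` -/
noncomputable def auxF (g : ℝ → ℝ) (u : ℝ) : ℂ :=
  ∫ t in Set.Ioi (0 : ℝ), Complex.exp (-(Complex.I * u * t)) * (g t : ℂ)

lemma aux_parts (u : ℝ) :
    auxF (fun t => 1 / (1 + t ^ 2)) u * (-(Complex.I * u)) +
      auxF (fun t => -(2 * t) / (1 + t ^ 2) ^ 2) u = -1 := by
  have i1 := aux_int u (fun t => 1 / (1 + t ^ 2))
    (by fun_prop (disch := exact aux_pos)) aux_b1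
  have i2 := aux_int u (fun t => -(2 * t) / (1 + t ^ 2) ^ 2)
    (Continuous.div (by fun_prop) (by fun_prop) fun t => pow_ne_zero 2 (aux_pos t)) aux_b2
  have hd : ∀ t : ℝ, HasDerivAt
      (fun t : ℝ => Complex.exp (-(Complex.I * u * t)) * ((1 / (1 + t ^ 2) : ℝ) : ℂ))
      (Complex.exp (-(Complex.I * u * t)) * ((1 / (1 + t ^ 2) : ℝ) : ℂ) * (-(Complex.I * u)) +
        Complex.exp (-(Complex.I * u * t)) * ((-(2 * t) / (1 + t ^ 2) ^ 2 : ℝ) : ℂ)) t := by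
    intro t
    refine aux_congr ((aux_exp_deriv u t).mul (aux_phi_deriv t).ofReal_comp) (fun y => rfl) ?_
    ring
  have h := integral_Ioi_of_hasDerivAt_of_tendsto' (a := 0) (fun t _ => hd t)
    ((i1.mul_const _).add i2) (aux_lim u _ aux_phi_lim)
  rw [integral_add (i1.mul_const _) i2, integral_mul_const] at h
  simp only [auxF]
  rw [h]; simp

lemma aux_parts2 (s : ℝ) (hs : s ≠ 0) :
    Tendsto (fun T : ℝ => 
          ∫ t in (0 : ℝ)..T, Complex.exp (-(Complex.I * s * t)) * ((t / (1 + t ^ 2) : ℝ) : ℂ))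
        atTop (nhds ((auxF (fun t => 1 / (1 + t ^ 2)) s +
          auxF (fun t => -(2 * t ^ 2) / (1 + t ^ 2) ^ 2) s) / (Complex.I * s))) := by
  have c1 : Continuous (fun t : ℝ => 1 / (1 + t ^ 2)) := by fun_prop (disch := exact aux_pos)
  have c3 : Continuous (fun t : ℝ => -(2 * t ^ 2) / (1 + t ^ 2) ^ 2) :=
    Continuous.div (by fun_prop) (by fun_prop) fun t => pow_ne_zero 2 (aux_pos t)
  have c0 : Continuous (fun t : ℝ => t / (1 + t ^ 2)) := by fun_prop (disch := exact aux_pos)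
  have i1 := aux_int s _ c1 aux_b1
  have i3 := aux_int s _ c3 aux_b3
  have hI : (Complex.I * s : ℂ) ≠ 0 := by simp [hs]
  have hd : ∀ t : ℝ, HasDerivAt
      (fun t : ℝ => Complex.exp (-(Complex.I * s * t)) * ((t / (1 + t ^ 2) : ℝ) : ℂ))
      (Complex.exp (-(Complex.I * s * t)) * ((t / (1 + t ^ 2) : ℝ) : ℂ) * (-(Complex.I * s)) +
        (Complex.exp (-(Complex.I * s * t)) * ((1 / (1 + t ^ 2) : ℝ) : ℂ) +
        Complex.exp (-(Complex.I * s * t)) * ((-(2 * t ^ 2) / (1 + t ^ 2) ^ 2 : ℝ) : ℂ))) t := by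
    intro t
    refine aux_congr ((aux_exp_deriv s t).mul (aux_psi_deriv t).ofReal_comp) (fun y => rfl) ?_
    push_cast
    ring
  have ce : Continuous (fun t : ℝ => Complex.exp (-(Complex.I * s * t))) := by fun_prop
  have d0 : Continuous (fun t : ℝ => Complex.exp (-(Complex.I * s * t)) * ((t / (1 + t ^ 2) : ℝ) : ℂ)) :=
    ce.mul (Complex.continuous_ofReal.comp c0)
  have d1 : Continuous (fun t : ℝ => Complex.exp (-(Complex.I * s * t)) * ((1 / (1 + t ^ 2) : ℝ) : ℂ)) :=
    ce.mul (Complex.continuous_ofReal.comp c1)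
  have d3 : Continuous (fun t : ℝ => Complex.exp (-(Complex.I * s * t)) * ((-(2 * t ^ 2) / (1 + t ^ 2) ^ 2 : ℝ) : ℂ)) :=
    ce.mul (Complex.continuous_ofReal.comp c3)
  have l1 := intervalIntegral_tendsto_integral_Ioi 0 (i1.add i3) tendsto_id
  have l2 := ((l1.sub (aux_lim s _ aux_psi_lim)).div_const (Complex.I * s))
  rw [sub_zero] at l2
  have e := integral_add i1 i3
  simp only [Pi.add_apply] at l2
  rw [e] at l2
  refine l2.congr fun T => ?_
  have h := intervalIntegral.integral_eq_sub_of_hasDerivAt (a := 0) (b := T) (fun t _ => hd t)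
    (((d0.mul continuous_const).add (d1.add d3)).intervalIntegrable _ _)
  have j0 : IntervalIntegrable (fun t : ℝ => Complex.exp (-(Complex.I * s * t)) *
      ((t / (1 + t ^ 2) : ℝ) : ℂ) * (-(Complex.I * s))) volume 0 T :=
    (d0.mul continuous_const).intervalIntegrable _ _
  have j1 : IntervalIntegrable (fun t : ℝ => Complex.exp (-(Complex.I * s * t)) *
      ((1 / (1 + t ^ 2) : ℝ) : ℂ) + Complex.exp (-(Complex.I * s * t)) *
      ((-(2 * t ^ 2) / (1 + t ^ 2) ^ 2 : ℝ) : ℂ)) volume 0 T :=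
    (d1.add d3).intervalIntegrable _ _
  rw [intervalIntegral.integral_add j0 j1, intervalIntegral.integral_mul_const] at h
  simp only [id]
  rw [div_eq_iff hI]
  simp only [zero_div, Complex.ofReal_zero, mul_zero, sub_zero] at h
  rw [← h]; ring

lemma aux_H (s : ℝ) : HasDerivAt (auxF (fun t => -(2 * t) / (1 + t ^ 2) ^ 2))
    (auxF (fun t => -(2 * t ^ 2) / (1 + t ^ 2) ^ 2) s * (-Complex.I)) s := by
  have c2 : Continuous (fun t : ℝ => -(2 * t) / (1 + t ^ 2) ^ 2) :=
    Continuous.div (by fun_prop) (by fun_prop) fun t => pow_ne_zero 2 (aux_pos t)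
  have c3 : Continuous (fun t : ℝ => -(2 * t ^ 2) / (1 + t ^ 2) ^ 2) :=
    Continuous.div (by fun_prop) (by fun_prop) fun t => pow_ne_zero 2 (aux_pos t)
  have i2 := fun u => aux_int u _ c2 aux_b2
  have i3 := fun u => aux_int u _ c3 aux_b3
  have h := hasDerivAt_integral_of_dominated_loc_of_deriv_le
    (μ := volume.restrict (Set.Ioi (0 : ℝ))) (x₀ := s) (s := Set.univ)
    (bound := fun t : ℝ => 2 * (1 + t ^ 2)⁻¹)
    (F := fun (u t : ℝ) => Complex.exp (-(Complex.I * u * t)) *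
      ((-(2 * t) / (1 + t ^ 2) ^ 2 : ℝ) : ℂ))
    (F' := fun (u t : ℝ) => Complex.exp (-(Complex.I * u * t)) *
      ((-(2 * t ^ 2) / (1 + t ^ 2) ^ 2 : ℝ) : ℂ) * (-Complex.I))
    Filter.univ_mem (Eventually.of_forall fun u => (i2 u).aestronglyMeasurable) (i2 s)
    ((i3 s).mul_const _).aestronglyMeasurable
    (ae_of_all _ fun t u _ => by
      rw [norm_mul, norm_mul, aux_norm_exp, one_mul, Complex.norm_real, norm_neg, Complex.norm_I,
        mul_one]
      exact aux_b3 t)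
    ((integrable_inv_one_add_sq.const_mul 2).restrict)
    (ae_of_all _ fun t u _ => by
      refine aux_congr ((aux_exp_deriv' u t).mul_const _) (fun y => rfl) ?_
      push_cast
      ring)
  have h2 := h.2
  rw [integral_mul_const] at h2
  exact h2

/-- Example 1: for `φ(t) = 1/(1+t²)` on `[0,∞)` (and `0` otherwise), the improper Fourier
integral `G(s)` of `g(t) = t·φ(t)` exists for every `s ≠ 0`, and the classical Fourier
transform `F₁(φ)` is differentiable at every `s ≠ 0` with derivative `-i·G(s)`. -/
theorem example1_deriv_fourier :
    ∀ s : ℝ, s ≠ 0 → ∃ G : ℂ,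
      Tendsto (fun T : ℝ => ((1 / Real.sqrt (2 * Real.pi) : ℝ) : ℂ) *
          ∫ t in (0 : ℝ)..T, Complex.exp (-(Complex.I * s * t)) * ((t / (1 + t ^ 2) : ℝ) : ℂ))
        atTop (nhds G) ∧
      HasDerivAt (fun u : ℝ => ((1 / Real.sqrt (2 * Real.pi) : ℝ) : ℂ) *
          ∫ t in Set.Ioi (0 : ℝ), Complex.exp (-(Complex.I * u * t)) * ((1 / (1 + t ^ 2) : ℝ) : ℂ))
        (-Complex.I * G) s := by
  intro s hs
  refine ⟨_, (aux_parts2 s hs).const_mul _, ?_⟩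
  have hF : ∀ u : ℝ, u ≠ 0 → auxF (fun t => 1 / (1 + t ^ 2)) u =
      (1 + auxF (fun t => -(2 * t) / (1 + t ^ 2) ^ 2) u) / (Complex.I * u) := by
    intro u hu
    have hI : (Complex.I * u : ℂ) ≠ 0 := by simp [hu]
    rw [eq_div_iff hI]
    linear_combination -(aux_parts u)
  have hI : (Complex.I * s : ℂ) ≠ 0 := by simp [hs]
  have hid : HasDerivAt (fun u : ℝ => Complex.I * (u : ℂ)) Complex.I s := by
    simpa using (hasDerivAt_id s).ofReal_comp.const_mul Complex.I
  have hq := ((aux_H s).const_add 1).div hid hI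
  have key : HasDerivAt (auxF (fun t => 1 / (1 + t ^ 2)))
      (-Complex.I * ((auxF (fun t => 1 / (1 + t ^ 2)) s +
          auxF (fun t => -(2 * t ^ 2) / (1 + t ^ 2) ^ 2) s) / (Complex.I * s))) s := by
    refine HasDerivAt.congr_of_eventuallyEq (?_ : HasDerivAt _ _ s)
      ((eventually_ne_nhds hs).mono fun u hu => hF u hu)
    refine aux_congr hq (fun y => rfl) ?_
    rw [hF s hs]
    have : (s : ℂ) ≠ 0 := by exact_mod_cast hs
    field_simp
    ring
  have := key.const_mul (((1 / Real.sqrt (2 * Real.pi) : ℝ) : ℂ))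
  refine aux_congr this (fun y => rfl) ?_
  ring
end
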